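/- Let 1<α<2, n≥3, ω>0. Define the kernel Γ_{α,n}(x,t) = 2^{−n} π^{(1−n)/2} t^{α−αn/2−1} f_{α/2}(t^{−α/2}|x|; n−1, α−αn/2) for x∈ℝⁿ∖{0}, t>0. Assume there exist constants C,σ>0 such that |Γ_{α,n}(x,t)| ≤ C t^{α−αn/2−1} μ_n(t^{−α/2}|x|) exp(−σ(t^{−α/2}|x|)^{2/(2−α)}) for all t>0, x≠0. Let F: ℝⁿ → ℂ be bounded and integrable, and set k(t,x) = ∫_0^t Γ_{α,n}(x, t−τ) E_α(i^α ω^α τ^α) dτ and u_3(t,x) = ∫_{ℝⁿ} k(t, x−ξ) F(ξ) dξ. Then for every x ∈ ℝⁿ, u_3(t,x)/E_α(i^α ω^α t^α) → ∫_{ℝⁿ} [∫_0^∞ Γ_{α,n}(x−ξ, τ) e^{−iωτ} dτ] F(ξ) dξ as t → ∞. -/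

import Mathlib

open MeasureTheory Filter Set

/-- The Mittag-Leffler function `E_{a,b}(z) = ∑ z^k / Γ(a k + b)`, where `1/Γ` is the
entire reciprocal Gamma function (Mathlib's `Real.Gamma` vanishes at the poles). -/
noncomputable def mittagLeffler (a b : ℝ) (z : ℂ) : ℂ :=
  ∑' k : ℕ, z ^ k / (Real.Gamma (a * k + b) : ℂ)

/-- `μ_n(z)` for `z > 0`: `1` if `n = 3`, `1 + |log z|` if `n = 4`, `z^{-n+4}` if `n ≥ 5`. -/
noncomputable def mun (n : ℕ) (z : ℝ) : ℝ :=
  if n = 3 then 1 else if n = 4 then 1 + |Real.log z| else z ^ ((4 : ℝ) - n)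

/-- The Wright function `Φ(-α/2, δ; z) = ∑ z^m / (m! Γ(δ - αm/2))`, with the entire
reciprocal Gamma function (Mathlib's `Real.Gamma` vanishes at the poles). -/
noncomputable def wrightPhi (α δ z : ℝ) : ℝ :=
  ∑' m : ℕ, z ^ m / ((m.factorial : ℝ) * Real.Gamma (δ - α * m / 2))

/-- `f_{α/2}(z; μ, δ) = (2/Γ(μ/2)) ∫_1^∞ Φ(-α/2, δ; -z t)(t²-1)^{μ/2-1} dt`. -/
noncomputable def fWright (α z μ δ : ℝ) : ℝ :=
  (2 / Real.Gamma (μ / 2)) * ∫ t in Ioi (1 : ℝ), wrightPhi α δ (-(z * t)) * (t ^ 2 - 1) ^ (μ / 2 - 1)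

/-- The kernel `Γ_{α,n}(x,t) = 2^{-n} π^{(1-n)/2} t^{α-αn/2-1} f_{α/2}(t^{-α/2}|x|; n-1, α-αn/2)`. -/
noncomputable def GammaKer (α : ℝ) (n : ℕ) (x : EuclideanSpace ℝ (Fin n)) (t : ℝ) : ℝ :=
  (2 : ℝ) ^ (-(n : ℝ)) * Real.pi ^ ((1 - (n : ℝ)) / 2) * t ^ (α - α * n / 2 - 1)
    * fWright α (t ^ (-α / 2) * ‖x‖) ((n : ℝ) - 1) (α - α * n / 2)

theorem laplace_rpow {s : ℝ} (hs : -1 < s) {p : ℂ} (hp : 0 < p.re) :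
    ∫ t in Ioi (0 : ℝ), ((t ^ s : ℝ) : ℂ) * Complex.exp (-(p * t))
      = Real.Gamma (s + 1) * p ^ (-(s + 1) : ℂ) := by
  set ν : Measure ℝ := (volume.restrict (Ioi 0)).withDensity (fun t => ENNReal.ofReal (t ^ s))
    with hν
  have hmeas : Measurable fun t : ℝ => ENNReal.ofReal (t ^ s) := by fun_prop
  have hmgf (q : ℂ) : ProbabilityTheory.complexMGF (fun t : ℝ => -t) ν q
      = ∫ t in Ioi (0 : ℝ), ((t ^ s : ℝ) : ℂ) * Complex.exp (-(q * t)) := by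
    rw [ProbabilityTheory.complexMGF, hν, integral_withDensity_eq_integral_toReal_smul hmeas
      (by filter_upwards with t; exact ENNReal.ofReal_lt_top)]
    refine setIntegral_congr_fun measurableSet_Ioi fun t ht => ?_
    have : (0 : ℝ) ≤ t ^ s := Real.rpow_nonneg (le_of_lt ht) _
    simp [ENNReal.toReal_ofReal this]
  have hset : Ioi (0 : ℝ) ⊆ interior (ProbabilityTheory.integrableExpSet (fun t : ℝ => -t) ν) := by
    refine interior_maximal (fun c hc => ?_) isOpen_Ioi
    have h := integrableOn_rpow_mul_exp_neg_mul_rpow (p := 1) hs one_pos (mem_Ioi.1 hc)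
    simp only [Real.rpow_one] at h
    rw [ProbabilityTheory.integrableExpSet, mem_ofPred_eq, hν,
      integrable_withDensity_iff_integrable_smul' hmeas
        (by filter_upwards with t; exact ENNReal.ofReal_lt_top)]
    refine h.congr_fun (fun t ht => ?_) measurableSet_Ioi
    have : (0 : ℝ) ≤ t ^ s := Real.rpow_nonneg (le_of_lt ht) _
    simp [ENNReal.toReal_ofReal this]
  set U : Set ℂ := {q | 0 < q.re} with hU
  have hUo : IsOpen U := isOpen_lt continuous_const Complex.continuous_re
  have hUc : IsPreconnected U := (convex_halfSpace_re_gt 0).isPreconnected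
  have h1 : AnalyticOnNhd ℂ (ProbabilityTheory.complexMGF (fun t : ℝ => -t) ν) U := by
    refine DifferentiableOn.analyticOnNhd ?_ hUo
    exact ProbabilityTheory.differentiableOn_complexMGF.mono fun q hq => hset hq
  have h2 : AnalyticOnNhd ℂ (fun p : ℂ => Real.Gamma (s + 1) * p ^ (-(s + 1) : ℂ)) U := by
    refine DifferentiableOn.analyticOnNhd (fun q hq => ?_) hUo
    refine DifferentiableAt.differentiableWithinAt ?_
    have : q ∈ Complex.slitPlane := Or.inl hq
    exact (DifferentiableAt.cpow_const differentiableAt_id this).const_mul _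
  have key := h1.eqOn_of_preconnected_of_frequently_eq h2 hUc (z₀ := 1) (by simp [hU]) ?_
  · rw [← hmgf]; exact key hp
  have hreal : ∀ r : ℝ, 0 < r → ProbabilityTheory.complexMGF (fun t : ℝ => -t) ν r
      = Real.Gamma (s + 1) * (r : ℂ) ^ (-(s + 1) : ℂ) := by
    intro r hr
    have h := Real.integral_rpow_mul_exp_neg_mul_Ioi (a := s + 1) (by linarith) hr
    rw [hmgf]
    have e : ∀ t : ℝ, ((t ^ s : ℝ) : ℂ) * Complex.exp (-((r : ℂ) * t))
        = ((t ^ (s + 1 - 1) * Real.exp (-(r * t)) : ℝ) : ℂ) := by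
      intro t; push_cast; simp
    simp_rw [e]
    rw [integral_complex_ofReal, h, one_div, Real.inv_rpow hr.le, ← Real.rpow_neg hr.le]
    push_cast [Complex.ofReal_cpow hr.le]
    ring
  have htend : Tendsto (fun n : ℕ => ((1 + 1 / ((n : ℝ) + 1) : ℝ) : ℂ)) atTop
      (nhdsWithin 1 {1}ᶜ) := by
    refine tendsto_nhdsWithin_iff.2 ⟨?_, ?_⟩
    · have := (tendsto_one_div_add_atTop_nhds_zero_nat (𝕜 := ℝ)).const_add 1
      have := (Complex.continuous_ofReal.tendsto _).comp this
      simpa [Function.comp_def] using this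
    · filter_upwards with n
      have : (0 : ℝ) < 1 / ((n : ℝ) + 1) := by positivity
      rw [mem_compl_iff, mem_singleton_iff, Complex.ofReal_eq_one]
      linarith
  refine htend.frequently (Frequently.of_forall fun n => hreal _ (by positivity))

theorem factorial_le_Gamma_mul_add_one {α : ℝ} (hα : 1 ≤ α) (k : ℕ) :
    (k.factorial : ℝ) ≤ Real.Gamma (α * k + 1) := by
  rcases Nat.eq_zero_or_pos k with rfl | hk
  · simp
  · have hk' : (1 : ℝ) ≤ k := by exact_mod_cast hk
    have h1 : (k : ℝ) + 1 ≤ α * k + 1 := by nlinarith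
    rw [← Real.Gamma_nat_eq_factorial]
    exact Real.Gamma_strictMonoOn_Ici.monotoneOn (mem_Ici.2 (by linarith))
      (mem_Ici.2 (by linarith)) h1

theorem norm_mittagLeffler_term_le {α : ℝ} (hα : 1 ≤ α) (z : ℂ) (k : ℕ) :
    ‖z ^ k / (Real.Gamma (α * k + 1) : ℂ)‖ ≤ ‖z‖ ^ k / k.factorial := by
  have h := factorial_le_Gamma_mul_add_one hα k
  have h0 : (0 : ℝ) < k.factorial := by positivity
  rw [norm_div, norm_pow, Complex.norm_real, Real.norm_of_nonneg (h0.le.trans h)]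
  gcongr

theorem continuous_mittagLeffler {α : ℝ} (hα : 1 ≤ α) : Continuous (mittagLeffler α 1) := by
  refine continuous_iff_continuousAt.2 fun z => ?_
  have h : ContinuousOn (mittagLeffler α 1) (Metric.ball 0 (‖z‖ + 1)) := by
    refine continuousOn_tsum (u := fun k : ℕ => (‖z‖ + 1) ^ k / k.factorial)
      (fun k => by fun_prop) (Real.summable_pow_div_factorial _) fun k w hw => ?_
    refine (norm_mittagLeffler_term_le hα w k).trans ?_
    have : ‖w‖ ≤ ‖z‖ + 1 := (mem_ball_zero_iff.1 hw).le
    gcongr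
  exact h.continuousAt (Metric.isOpen_ball.mem_nhds (by simp))

theorem mittagLeffler_zero (α : ℝ) : mittagLeffler α 1 0 = 1 := by
  rw [mittagLeffler, tsum_eq_single 0]
  · simp
  · intro k hk; simp [hk]

/-- The `k`-th term of the Laplace integrand of `t ↦ E_α(μ t^α)`. -/
noncomputable def laplaceTerm (α : ℝ) (μ p : ℂ) (k : ℕ) (t : ℝ) : ℂ :=
  (μ * ((t ^ α : ℝ) : ℂ)) ^ k / (Real.Gamma (α * k + 1) : ℂ) * Complex.exp (-(p * t))

theorem laplaceTerm_eq {α : ℝ} (μ p : ℂ) (k : ℕ) {t : ℝ} (ht : 0 ≤ t) :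
    laplaceTerm α μ p k t = μ ^ k / (Real.Gamma (α * k + 1) : ℂ)
      * (((t ^ (α * k) : ℝ) : ℂ) * Complex.exp (-(p * t))) := by
  rw [laplaceTerm, mul_pow, Real.rpow_mul ht, Real.rpow_natCast]
  push_cast
  ring

theorem norm_laplaceTerm {α : ℝ} (hα : 1 ≤ α) (μ p : ℂ) (k : ℕ) {t : ℝ} (ht : 0 ≤ t) :
    (‖laplaceTerm α μ p k t‖ : ℂ) = laplaceTerm α ‖μ‖ p.re k t := by
  have h0 : (0 : ℝ) ≤ Real.Gamma (α * k + 1) :=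
    le_trans (by positivity) (factorial_le_Gamma_mul_add_one hα k)
  have h1 : (0 : ℝ) ≤ t ^ α := by positivity
  rw [laplaceTerm, laplaceTerm, norm_mul, norm_div, norm_pow, norm_mul, Complex.norm_real,
    Complex.norm_real, Real.norm_of_nonneg h0, Real.norm_of_nonneg h1, Complex.norm_exp]
  push_cast
  simp

theorem integral_laplaceTerm {α : ℝ} (hα : 1 ≤ α) (μ : ℂ) {p : ℂ} (hp : 0 < p.re) (k : ℕ) :
    ∫ t in Ioi (0 : ℝ), laplaceTerm α μ p k t = p⁻¹ * (μ / p ^ (α : ℂ)) ^ k := by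
  have hp0 : p ≠ 0 := by rintro rfl; simp at hp
  have hk : (0 : ℝ) ≤ α * k := by positivity
  have hG : (Real.Gamma (α * k + 1) : ℂ) ≠ 0 :=
    Complex.ofReal_ne_zero.2 (Real.Gamma_pos_of_pos (by linarith)).ne'
  rw [setIntegral_congr_fun measurableSet_Ioi fun t ht => laplaceTerm_eq μ p k (le_of_lt ht),
    integral_const_mul, laplace_rpow (by linarith) hp]
  have : p ^ (-(((α * k : ℝ) : ℂ) + 1)) = p⁻¹ * ((p ^ (α : ℂ)) ^ k)⁻¹ := by
    rw [Complex.cpow_neg, Complex.cpow_add _ _ hp0, Complex.cpow_one, Complex.ofReal_mul,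
      Complex.ofReal_natCast, Complex.cpow_mul_nat, mul_inv, mul_comm]
  rw [this, div_pow]
  field_simp

theorem integrableOn_laplaceTerm {α : ℝ} (hα : 1 ≤ α) (μ : ℂ) {p : ℂ} (hp : 0 < p.re) (k : ℕ) :
    IntegrableOn (laplaceTerm α μ p k) (Ioi 0) := by
  have hk : (0 : ℝ) ≤ α * k := by positivity
  have h := (integrableOn_rpow_mul_exp_neg_mul_rpow (p := 1) (s := α * k) (by linarith)
    one_pos hp).const_mul (‖μ ^ k / (Real.Gamma (α * k + 1) : ℂ)‖)
  simp only [Real.rpow_one] at h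
  refine Integrable.mono' h ?_ ?_
  · unfold laplaceTerm
    exact Measurable.aestronglyMeasurable (by fun_prop)
  · filter_upwards [ae_restrict_mem measurableSet_Ioi] with t ht
    have : (0 : ℝ) ≤ t ^ (α * k) := Real.rpow_nonneg (le_of_lt ht) _
    rw [laplaceTerm_eq μ p k (le_of_lt ht), norm_mul, norm_mul, Complex.norm_exp,
      Complex.norm_real, Real.norm_of_nonneg this]
    simp

theorem hasSum_laplaceTerm {α : ℝ} (hα : 1 ≤ α) {μ p : ℂ} (hp : 0 < p.re)
    (hμ : ‖μ‖ < p.re ^ α) :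
    Integrable (fun t : ℝ => mittagLeffler α 1 (μ * ((t ^ α : ℝ) : ℂ)) * Complex.exp (-(p * t)))
      (volume.restrict (Ioi 0)) ∧
    ∫ t in Ioi (0 : ℝ), mittagLeffler α 1 (μ * ((t ^ α : ℝ) : ℂ)) * Complex.exp (-(p * t))
      = p ^ (α - 1 : ℂ) / (p ^ (α : ℂ) - μ) := by
  have hp0 : p ≠ 0 := by rintro rfl; simp at hp
  have hc0 : (p.re : ℂ) ≠ 0 := Complex.ofReal_ne_zero.2 hp.ne'
  have htsum (ν q : ℂ) (t : ℝ) : ∑' k, laplaceTerm α ν q k t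
      = mittagLeffler α 1 (ν * ((t ^ α : ℝ) : ℂ)) * Complex.exp (-(q * t)) := by
    simp only [laplaceTerm, mittagLeffler]
    rw [tsum_mul_right]
  have hint (ν : ℂ) (q : ℂ) (hq : q.re = p.re) (hν : ‖ν‖ = ‖μ‖) (k : ℕ) :
      ∫ t in Ioi (0 : ℝ), ‖laplaceTerm α ν q k t‖ = p.re⁻¹ * (‖μ‖ / p.re ^ α) ^ k := by
    have : ((∫ t in Ioi (0 : ℝ), ‖laplaceTerm α ν q k t‖ : ℝ) : ℂ)
        = ((p.re⁻¹ * (‖μ‖ / p.re ^ α) ^ k : ℝ) : ℂ) := by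
      rw [← integral_complex_ofReal, setIntegral_congr_fun measurableSet_Ioi
        fun t ht => norm_laplaceTerm hα ν q k (le_of_lt ht),
        integral_laplaceTerm hα _ (by simpa [hq])]
      rw [hq, hν]
      push_cast [Complex.ofReal_cpow hp.le]
      rfl
    exact_mod_cast this
  have hr0 : 0 ≤ ‖μ‖ / p.re ^ α := by positivity
  have hr1 : ‖μ‖ / p.re ^ α < 1 := (div_lt_one (by positivity)).2 hμ
  have hgeo : Summable fun k : ℕ => p.re⁻¹ * (‖μ‖ / p.re ^ α) ^ k :=
    (summable_geometric_of_lt_one hr0 hr1).mul_left _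
  have hsum (ν q : ℂ) (hq : q.re = p.re) (hν : ‖ν‖ = ‖μ‖) :=
    hasSum_integral_of_summable_integral_norm (F := fun k => laplaceTerm α ν q k)
      (μ := volume.restrict (Ioi 0)) (fun k => integrableOn_laplaceTerm hα ν (by rwa [hq]) k)
      (by simp_rw [hint ν q hq hν]; exact hgeo)
  have hnormsummable (t : ℝ) : Summable fun k => ‖laplaceTerm α μ p k t‖ := by
    simp only [laplaceTerm, norm_mul (_ / _)]
    refine Summable.mul_right _ (Summable.of_nonneg_of_le (fun _ => norm_nonneg _)
      (fun k => norm_mittagLeffler_term_le hα _ k) (Real.summable_pow_div_factorial _))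
  have hmeas : Continuous fun t : ℝ =>
      mittagLeffler α 1 (μ * ((t ^ α : ℝ) : ℂ)) * Complex.exp (-(p * t)) := by
    have := continuous_mittagLeffler hα
    have : Continuous fun t : ℝ => t ^ α := Real.continuous_rpow_const (by linarith)
    fun_prop
  constructor
  · have hI : Integrable (fun t : ℝ => mittagLeffler α 1 ((‖μ‖ : ℂ) * ((t ^ α : ℝ) : ℂ))
        * Complex.exp (-((p.re : ℂ) * t))) (volume.restrict (Ioi 0)) := by
      refine not_imp_comm.1 integral_undef ?_
      have h2 := (hsum (‖μ‖ : ℂ) (p.re : ℂ) (by simp) (by simp)).tsum_eq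
      simp_rw [htsum] at h2
      rw [← h2]
      simp_rw [integral_laplaceTerm hα (‖μ‖ : ℂ) (p := (p.re : ℂ)) (by simpa)]
      rw [tsum_mul_left, tsum_geometric_of_norm_lt_one]
      · refine mul_ne_zero (inv_ne_zero hc0) (inv_ne_zero ?_)
        rw [← Complex.ofReal_cpow hp.le, ← Complex.ofReal_div, ← Complex.ofReal_one,
          ← Complex.ofReal_sub, Complex.ofReal_ne_zero]
        linarith
      · rw [← Complex.ofReal_cpow hp.le, ← Complex.ofReal_div, Complex.norm_real,
          Real.norm_of_nonneg hr0]
        exact hr1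
    refine hI.norm.mono' hmeas.aestronglyMeasurable ?_
    filter_upwards [ae_restrict_mem measurableSet_Ioi] with t ht
    rw [← htsum, ← htsum]
    refine (norm_tsum_le_tsum_norm (hnormsummable t)).trans ?_
    have : ∑' k, laplaceTerm α ‖μ‖ p.re k t = ((∑' k, ‖laplaceTerm α μ p k t‖ : ℝ) : ℂ) := by
      rw [Complex.ofReal_tsum]
      exact tsum_congr fun k => (norm_laplaceTerm hα μ p k (le_of_lt ht)).symm
    rw [this, Complex.norm_real]
    exact Real.le_norm_self _
  · have h2 := (hsum μ p rfl rfl).tsum_eq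
    simp_rw [htsum] at h2
    rw [← h2]
    simp_rw [integral_laplaceTerm hα μ hp]
    have hpa : p ^ (α : ℂ) ≠ 0 := by simp [Complex.cpow_eq_zero_iff, hp0]
    have hle : p.re ^ α ≤ ‖p ^ (α : ℂ)‖ := by
      rw [Complex.norm_cpow_real]
      exact Real.rpow_le_rpow hp.le (Complex.re_le_norm p) (by linarith)
    have hsub : p ^ (α : ℂ) - μ ≠ 0 := by
      intro h
      rw [sub_eq_zero] at h
      rw [h] at hle
      linarith
    rw [tsum_mul_left, tsum_geometric_of_norm_lt_one, Complex.cpow_sub _ _ hp0, Complex.cpow_one]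
    · field_simp
    · rw [norm_div, div_lt_one (norm_pos_iff.2 hpa)]
      linarith

theorem cpow_eq_I_mul_cpow_iff {α ω : ℝ} (hα₁ : 0 < α) (hα₂ : α < 2) (hω : 0 < ω) {p : ℂ}
    (hp : 0 ≤ p.re) (h : p ^ (α : ℂ) = (Complex.I * ω) ^ (α : ℂ)) : p = Complex.I * ω := by
  have hIω : Complex.I * (ω : ℂ) ≠ 0 :=
    mul_ne_zero Complex.I_ne_zero (Complex.ofReal_ne_zero.2 hω.ne')
  have hnorm : ‖p‖ = ω := by
    have h1 := congrArg norm h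
    rw [Complex.norm_cpow_real, Complex.norm_cpow_real] at h1
    have := (Real.rpow_left_inj (norm_nonneg _) (norm_nonneg _) hα₁.ne').1 h1
    simpa [abs_of_pos hω] using this
  have hp0 : p ≠ 0 := by rintro rfl; simp at hnorm; linarith
  have harg : (Complex.I * (ω : ℂ)).arg = Real.pi / 2 := by
    rw [mul_comm, Complex.arg_real_mul _ hω, Complex.arg_I]
  rw [Complex.cpow_def_of_ne_zero hp0, Complex.cpow_def_of_ne_zero hIω,
    Complex.exp_eq_exp_iff_exists_int] at h
  obtain ⟨m, hm⟩ := h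
  have him := congrArg Complex.im hm
  simp only [Complex.mul_im, Complex.add_im, Complex.log_im, Complex.log_re, Complex.ofReal_im,
    Complex.ofReal_re, harg] at him
  simp at him
  have habs := abs_le.1 (Complex.abs_arg_le_pi_div_two_iff.2 hp)
  have hpi := Real.pi_pos
  have hm0 : m = 0 := by
    have h1 : (m : ℝ) < 1 := by
      by_contra! hc
      nlinarith [mul_le_mul_of_nonneg_right habs.2 hα₁.le]
    have h2 : (-1 : ℝ) < m := by
      by_contra! hc
      nlinarith [mul_le_mul_of_nonneg_right habs.1 hα₁.le]
    have h1' : m < 1 := by exact_mod_cast h1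
    have h2' : -1 < m := by exact_mod_cast h2
    omega
  rw [hm0] at him
  have harg' : p.arg = Real.pi / 2 := by
    have : p.arg * α = Real.pi / 2 * α := by simpa using him
    exact mul_right_cancel₀ hα₁.ne' this
  refine Complex.ext_norm_arg ?_ (harg'.trans harg.symm)
  simp [hnorm, abs_of_pos hω]

/-- The quotient `(p^α - (iω)^α) / (p - iω)`, with the removable singularity filled in. -/
noncomputable def cpowSlope (α ω : ℝ) : ℂ → ℂ :=
  dslope (fun p : ℂ => p ^ (α : ℂ)) (Complex.I * ω)

/-- The Laplace transform of `E_α((iω)^α t^α) - e^{iωt} / α - (1 - 1/α) e^{-t}`, with its removable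
singularity at `iω` filled in. -/
noncomputable def remainderLaplace (α ω : ℝ) (p : ℂ) : ℂ :=
  dslope (fun p : ℂ => α * p ^ (α - 1 : ℂ) - cpowSlope α ω p) (Complex.I * ω) p
    / (α * cpowSlope α ω p) - (1 - (α : ℂ)⁻¹) / (p + 1)

theorem I_mul_mem_slitPlane {ω : ℝ} (hω : 0 < ω) : Complex.I * (ω : ℂ) ∈ Complex.slitPlane := by
  right; simp [hω.ne']

theorem cpowSlope_of_ne {α ω : ℝ} {p : ℂ} (hp : p ≠ Complex.I * ω) :
    cpowSlope α ω p = (p ^ (α : ℂ) - (Complex.I * ω) ^ (α : ℂ)) / (p - Complex.I * ω) := by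
  rw [cpowSlope, dslope_of_ne _ hp, slope_def_field]

theorem cpowSlope_I_mul {α ω : ℝ} (hω : 0 < ω) :
    cpowSlope α ω (Complex.I * ω) = α * (Complex.I * ω) ^ (α - 1 : ℂ) := by
  rw [cpowSlope, dslope_same]
  have := (hasDerivAt_id (Complex.I * (ω : ℂ))).cpow_const (c := (α : ℂ)) (I_mul_mem_slitPlane hω)
  simpa using this.deriv

theorem cpowSlope_ne_zero {α ω : ℝ} (hα₁ : 0 < α) (hα₂ : α < 2) (hω : 0 < ω) {p : ℂ}
    (hp : 0 ≤ p.re) : cpowSlope α ω p ≠ 0 := by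
  by_cases h : p = Complex.I * ω
  · subst h
    rw [cpowSlope_I_mul hω]
    simp [Complex.cpow_eq_zero_iff, hα₁.ne', hω.ne']
  · rw [cpowSlope_of_ne h]
    exact div_ne_zero (fun h' => h (cpow_eq_I_mul_cpow_iff hα₁ hα₂ hω hp (sub_eq_zero.1 h')))
      (sub_ne_zero.2 h)

theorem remainderLaplace_of_ne {α ω : ℝ} (hα₁ : 1 < α) (hα₂ : α < 2) (hω : 0 < ω) {p : ℂ}
    (hp : 0 ≤ p.re) (hne : p ≠ Complex.I * ω) :
    remainderLaplace α ω p = p ^ (α - 1 : ℂ) / (p ^ (α : ℂ) - (Complex.I * ω) ^ (α : ℂ))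
      - (α : ℂ)⁻¹ / (p - Complex.I * ω) - (1 - (α : ℂ)⁻¹) / (p + 1) := by
  have hα0 : (α : ℂ) ≠ 0 := Complex.ofReal_ne_zero.2 (by linarith)
  have h1 : p - Complex.I * ω ≠ 0 := sub_ne_zero.2 hne
  have h2 : p ^ (α : ℂ) - (Complex.I * ω) ^ (α : ℂ) ≠ 0 := fun h =>
    hne (cpow_eq_I_mul_cpow_iff (by linarith) hα₂ hω hp (sub_eq_zero.1 h))
  rw [remainderLaplace, dslope_of_ne _ hne, slope_def_field, cpowSlope_I_mul hω,
    cpowSlope_of_ne hne]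
  congr 1
  field_simp
  ring

theorem differentiableOn_cpowSlope {α ω : ℝ} (hω : 0 < ω) :
    DifferentiableOn ℂ (cpowSlope α ω) Complex.slitPlane := by
  refine (Complex.differentiableOn_dslope
    (Complex.isOpen_slitPlane.mem_nhds (I_mul_mem_slitPlane hω))).2 fun p hp => ?_
  exact (differentiableAt_id.cpow_const hp).differentiableWithinAt

theorem continuousAt_cpow_const_zero {s : ℂ} (hs : 0 < s.re) :
    ContinuousAt (fun p : ℂ => p ^ s) 0 :=
  ContinuousAt.comp (f := fun p : ℂ => (p, s)) (Complex.continuousAt_cpow_zero_of_re_pos hs)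
    (by fun_prop)

theorem add_one_ne_zero_of_re_nonneg {p : ℂ} (hp : 0 ≤ p.re) : p + 1 ≠ 0 := by
  intro h
  have := congrArg Complex.re h
  simp at this
  linarith

theorem differentiableAt_remainderLaplace {α ω : ℝ} (hα₁ : 1 < α) (hα₂ : α < 2) (hω : 0 < ω)
    {p : ℂ} (hp : 0 ≤ p.re) (hp0 : p ≠ 0) : DifferentiableAt ℂ (remainderLaplace α ω) p := by
  have hα0 : (α : ℂ) ≠ 0 := Complex.ofReal_ne_zero.2 (by linarith)
  have hmem : p ∈ Complex.slitPlane := by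
    rcases hp.lt_or_eq with h | h
    · exact Or.inl h
    · exact Or.inr fun h' => hp0 (Complex.ext h.symm h')
  have hnhds := Complex.isOpen_slitPlane.mem_nhds hmem
  have hD := (differentiableOn_cpowSlope (α := α) hω).differentiableAt hnhds
  have hN : DifferentiableOn ℂ (dslope (fun p : ℂ => α * p ^ (α - 1 : ℂ) - cpowSlope α ω p)
      (Complex.I * ω)) Complex.slitPlane := by
    refine (Complex.differentiableOn_dslope
      (Complex.isOpen_slitPlane.mem_nhds (I_mul_mem_slitPlane hω))).2 ?_
    refine DifferentiableOn.sub (fun q hq => ?_) (differentiableOn_cpowSlope hω)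
    exact ((differentiableAt_id.cpow_const hq).const_mul _).differentiableWithinAt
  unfold remainderLaplace
  refine ((hN.differentiableAt hnhds).div (hD.const_mul _)
    (mul_ne_zero hα0 (cpowSlope_ne_zero (by linarith) hα₂ hω hp))).sub ?_
  exact (differentiableAt_const _).div (by fun_prop) (add_one_ne_zero_of_re_nonneg hp)

theorem continuousAt_remainderLaplace {α ω : ℝ} (hα₁ : 1 < α) (hα₂ : α < 2) (hω : 0 < ω)
    {p : ℂ} (hp : 0 ≤ p.re) : ContinuousAt (remainderLaplace α ω) p := by
  by_cases hp0 : p = 0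
  · subst hp0
    have hα0 : (α : ℂ) ≠ 0 := Complex.ofReal_ne_zero.2 (by linarith)
    have hIω : (0 : ℂ) ≠ Complex.I * (ω : ℂ) :=
      (mul_ne_zero Complex.I_ne_zero (Complex.ofReal_ne_zero.2 hω.ne')).symm
    have hD : ContinuousAt (cpowSlope α ω) 0 :=
      (continuousAt_dslope_of_ne hIω).2 (continuousAt_cpow_const_zero (by simp; linarith))
    unfold remainderLaplace
    refine ContinuousAt.sub (ContinuousAt.div ((continuousAt_dslope_of_ne hIω).2 ?_)
      (hD.const_mul _) (mul_ne_zero hα0 (cpowSlope_ne_zero (by linarith) hα₂ hω hp))) ?_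
    · exact ((continuousAt_cpow_const_zero (by simp; linarith)).const_mul _).sub hD
    · exact continuousAt_const.div (by fun_prop) (add_one_ne_zero_of_re_nonneg hp)
  · exact (differentiableAt_remainderLaplace hα₁ hα₂ hω hp hp0).continuousAt

theorem exists_norm_remainderLaplace_le {α ω : ℝ} (hα₁ : 1 < α) (hα₂ : α < 2) (hω : 0 < ω) :
    ∃ R K : ℝ, 0 < R ∧ ∀ p : ℂ, 0 ≤ p.re → R ≤ ‖p‖ →
      ‖remainderLaplace α ω p‖ ≤ K / ‖p‖ ^ 2 := by
  have hα0 : (α : ℂ) ≠ 0 := Complex.ofReal_ne_zero.2 (by linarith)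
  refine ⟨1 + 2 * ω + 2 * ω ^ α, 2 * ω ^ α + (2 * ω + 1), by positivity, fun p hp hR => ?_⟩
  have hωα : 0 < ω ^ α := Real.rpow_pos_of_pos hω _
  have hp1 : 1 ≤ ‖p‖ := by linarith
  have hpp : 0 < ‖p‖ := by linarith
  have hp0 : p ≠ 0 := norm_pos_iff.1 (by linarith)
  have hnI : ‖Complex.I * (ω : ℂ)‖ = ω := by simp [abs_of_pos hω]
  have hne : p ≠ Complex.I * ω := by
    intro h
    have := congrArg norm h
    rw [hnI] at this
    linarith
  have h1 : p - Complex.I * ω ≠ 0 := sub_ne_zero.2 hne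
  have h2 : p ^ (α : ℂ) - (Complex.I * ω) ^ (α : ℂ) ≠ 0 := fun h =>
    hne (cpow_eq_I_mul_cpow_iff (by linarith) hα₂ hω hp (sub_eq_zero.1 h))
  have h3 := add_one_ne_zero_of_re_nonneg hp
  have hn1 : ‖p‖ / 2 ≤ ‖p - Complex.I * ω‖ := by
    have := norm_sub_norm_le p (Complex.I * ω)
    rw [hnI] at this
    linarith
  have hn2 : ‖p‖ / 2 ≤ ‖p ^ (α : ℂ) - (Complex.I * ω) ^ (α : ℂ)‖ := by
    have := norm_sub_norm_le (p ^ (α : ℂ)) ((Complex.I * ω) ^ (α : ℂ))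
    rw [Complex.norm_cpow_real, Complex.norm_cpow_real, hnI] at this
    have h4 := Real.rpow_le_rpow_of_exponent_le hp1 hα₁.le
    rw [Real.rpow_one] at h4
    linarith
  have hn3 : ‖p‖ ≤ ‖p + 1‖ := by
    rw [Complex.norm_def, Complex.norm_def]
    refine Real.sqrt_le_sqrt ?_
    simp only [Complex.normSq_apply, Complex.add_re, Complex.add_im, Complex.one_re,
      Complex.one_im]
    nlinarith
  have heq : remainderLaplace α ω p
      = (Complex.I * ω) ^ (α : ℂ) / (p * (p ^ (α : ℂ) - (Complex.I * ω) ^ (α : ℂ)))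
        + ((α : ℂ)⁻¹ * (-(Complex.I * ω)) / (p * (p - Complex.I * ω))
        + (1 - (α : ℂ)⁻¹) / (p * (p + 1))) := by
    rw [remainderLaplace_of_ne hα₁ hα₂ hω hp hne, Complex.cpow_sub _ _ hp0, Complex.cpow_one]
    field_simp
    ring
  have hαinv : ‖(α : ℂ)⁻¹‖ ≤ 1 := by
    rw [norm_inv, Complex.norm_real, Real.norm_of_nonneg (by linarith)]
    exact inv_le_one_of_one_le₀ hα₁.le
  have hαinv' : ‖1 - (α : ℂ)⁻¹‖ ≤ 1 := by
    rw [← Complex.ofReal_inv, ← Complex.ofReal_one, ← Complex.ofReal_sub, Complex.norm_real,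
      Real.norm_of_nonneg]
    · have : 0 ≤ α⁻¹ := inv_nonneg.2 (by linarith)
      linarith
    · have := inv_le_one_of_one_le₀ hα₁.le
      linarith
  rw [heq, add_div, add_div]
  refine norm_add_le_of_le ?_ (norm_add_le_of_le ?_ ?_)
  · rw [norm_div, norm_mul, Complex.norm_cpow_real, hnI]
    calc ω ^ α / (‖p‖ * ‖p ^ (α : ℂ) - (Complex.I * ω) ^ (α : ℂ)‖)
        ≤ ω ^ α / (‖p‖ * (‖p‖ / 2)) := by gcongr
      _ = 2 * ω ^ α / ‖p‖ ^ 2 := by field_simp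
  · rw [norm_div, norm_mul, norm_mul, norm_neg, hnI]
    calc ‖(α : ℂ)⁻¹‖ * ω / (‖p‖ * ‖p - Complex.I * ω‖)
        ≤ 1 * ω / (‖p‖ * (‖p‖ / 2)) := by gcongr
      _ = 2 * ω / ‖p‖ ^ 2 := by field_simp
  · rw [norm_div, norm_mul]
    calc ‖1 - (α : ℂ)⁻¹‖ / (‖p‖ * ‖p + 1‖) ≤ 1 / (‖p‖ * ‖p‖) := by gcongr
      _ = 1 / ‖p‖ ^ 2 := by rw [sq]

theorem integrable_vertical {V : ℂ → ℂ} {R K : ℝ} (hV : ∀ p : ℂ, 0 ≤ p.re → ContinuousAt V p)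
    (hbd : ∀ p : ℂ, 0 ≤ p.re → R ≤ ‖p‖ → ‖V p‖ ≤ K / ‖p‖ ^ 2) {c : ℝ} (hc : 0 ≤ c) :
    Integrable fun y : ℝ => V (c + y * Complex.I) := by
  have hcont : Continuous fun y : ℝ => V (c + y * Complex.I) := by
    refine continuous_iff_continuousAt.2 fun y => ?_
    exact ContinuousAt.comp (f := fun y : ℝ => (c + y * Complex.I : ℂ)) (hV _ (by simpa))
      (by fun_prop)
  refine hcont.locallyIntegrable.integrable_of_isBigO_cocompact
    (g := fun y : ℝ => (1 + y ^ 2)⁻¹) ?_ (integrable_inv_one_add_sq.integrableAtFilter _)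
  refine Asymptotics.IsBigO.of_bound (2 * |K|) ?_
  have hev : ∀ᶠ y : ℝ in cocompact ℝ, max R 1 ≤ ‖y‖ :=
    (tendsto_norm_cocompact_atTop (E := ℝ)).eventually_ge_atTop _
  filter_upwards [hev] with y hy
  have hy1 : 1 ≤ |y| := (le_max_right _ _).trans hy
  have hp : |y| ≤ ‖(c + y * Complex.I : ℂ)‖ := by
    simpa using Complex.abs_im_le_norm (c + y * Complex.I : ℂ)
  have h1 : 1 ≤ y ^ 2 := by rw [← sq_abs]; nlinarith
  calc ‖V (c + y * Complex.I)‖ ≤ K / ‖(c + y * Complex.I : ℂ)‖ ^ 2 :=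
        hbd _ (by simpa) (((le_max_left _ _).trans hy).trans hp)
    _ ≤ |K| / |y| ^ 2 := by gcongr; exact le_abs_self K
    _ = |K| / y ^ 2 := by rw [sq_abs]
    _ ≤ 2 * |K| / (1 + y ^ 2) := by
        rw [div_le_div_iff₀ (by positivity) (by positivity)]
        nlinarith [abs_nonneg K, mul_nonneg (abs_nonneg K) (sub_nonneg.2 h1)]
    _ = 2 * |K| * ‖(1 + y ^ 2)⁻¹‖ := by
        rw [Real.norm_of_nonneg (by positivity)]; rfl

theorem norm_cexp_mul_ofReal (p : ℂ) (t : ℝ) : ‖Complex.exp (p * t)‖ = Real.exp (p.re * t) := by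
  simp [Complex.norm_exp]

theorem integral_vertical_shift {V : ℂ → ℂ} {R K : ℝ}
    (hV : ∀ p : ℂ, 0 ≤ p.re → ContinuousAt V p)
    (hVd : ∀ p : ℂ, 0 < p.re → DifferentiableAt ℂ V p)
    (hbd : ∀ p : ℂ, 0 ≤ p.re → R ≤ ‖p‖ → ‖V p‖ ≤ K / ‖p‖ ^ 2) {c t : ℝ} (hc : 0 ≤ c)
    (ht : 0 ≤ t) :
    ∫ y : ℝ, Complex.exp ((c + y * Complex.I) * t) * V (c + y * Complex.I)
      = ∫ y : ℝ, Complex.exp (y * Complex.I * t) * V (y * Complex.I) := by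
  set g : ℂ → ℂ := fun p => Complex.exp (p * t) * V p with hg
  have hint (b : ℝ) (hb : 0 ≤ b) : Integrable fun y : ℝ => g (b + y * Complex.I) := by
    refine (integrable_vertical hV hbd hb).bdd_mul (c := Real.exp (b * t)) ?_ ?_
    · exact Continuous.aestronglyMeasurable (by fun_prop)
    · filter_upwards with y
      rw [norm_cexp_mul_ofReal]
      simp
  have hrect (T : ℝ) := Complex.integral_boundary_rect_eq_zero_of_continuousOn_of_differentiableOn g
    (0 + (-T : ℝ) * Complex.I) (c + T * Complex.I)
  simp only [Complex.add_re, Complex.mul_re, Complex.ofReal_re, Complex.I_re, mul_zero,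
    Complex.ofReal_im, Complex.I_im, mul_one, sub_self, add_zero, Complex.add_im,
    Complex.mul_im, zero_add, Complex.ofReal_zero] at hrect
  have hrect' (T : ℝ) : Complex.I • (∫ y in (-T)..T, g (c + y * Complex.I))
      - Complex.I • (∫ y in (-T)..T, g (y * Complex.I))
      = (∫ x in (0 : ℝ)..c, g (x + T * Complex.I))
        - ∫ x in (0 : ℝ)..c, g (x + (-T : ℝ) * Complex.I) := by
    have h := hrect T ?_ ?_
    · linear_combination h
    · rintro p ⟨hp, -⟩
      have hp' : 0 ≤ p.re := by
        have := hp
        simp only [mem_preimage, uIcc_of_le hc] at this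
        exact this.1
      exact (ContinuousAt.mul (by fun_prop) (hV p hp')).continuousWithinAt
    · rintro p ⟨hp, -⟩
      have hp' : 0 < p.re := by
        have := hp
        simp only [mem_preimage, min_eq_left hc] at this
        exact this.1
      exact (DifferentiableAt.mul (by fun_prop) (hVd p hp')).differentiableWithinAt
  have hlim (b : ℝ) (hb : 0 ≤ b) := intervalIntegral_tendsto_integral (hint b hb)
    tendsto_neg_atTop_atBot tendsto_id
  have hbound : Tendsto (fun T : ℝ => Real.exp (c * t) * (|K| / T ^ 2) * |c - 0|) atTop
      (nhds 0) := by
    have : Tendsto (fun T : ℝ => |K| / T ^ 2) atTop (nhds 0) :=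
      tendsto_const_nhds.div_atTop (tendsto_pow_atTop two_ne_zero)
    simpa using (this.const_mul (Real.exp (c * t))).mul_const |c - 0|
  have hhor (s : ℝ) (hs : |s| = 1) :
      Tendsto (fun T : ℝ => ∫ x in (0 : ℝ)..c, g (x + ((s * T : ℝ) : ℂ) * Complex.I)) atTop
        (nhds 0) := by
    refine squeeze_zero_norm' ?_ hbound
    filter_upwards [eventually_ge_atTop R, eventually_gt_atTop 0] with T hT hT0
    refine intervalIntegral.norm_integral_le_of_norm_le_const fun x hx => ?_
    rw [uIoc_of_le hc] at hx
    have hTp : T ≤ ‖(x + ((s * T : ℝ) : ℂ) * Complex.I : ℂ)‖ := by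
      have := Complex.abs_im_le_norm (x + ((s * T : ℝ) : ℂ) * Complex.I : ℂ)
      simpa [abs_mul, hs, abs_of_pos hT0] using this
    have hre : (x + ((s * T : ℝ) : ℂ) * Complex.I : ℂ).re = x := by simp
    rw [hg, norm_mul, norm_cexp_mul_ofReal, hre]
    have h1 := hbd (x + ((s * T : ℝ) : ℂ) * Complex.I) (by rw [hre]; exact hx.1.le)
      (hT.trans hTp)
    have h2 : K / ‖(x + ((s * T : ℝ) : ℂ) * Complex.I : ℂ)‖ ^ 2 ≤ |K| / T ^ 2 := by
      gcongr
      exact le_abs_self K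
    have := hx.2
    exact mul_le_mul (Real.exp_le_exp.2 (by gcongr)) (h1.trans h2) (norm_nonneg _) (by positivity)
  have hL := ((hlim c hc).const_smul Complex.I).sub ((hlim 0 le_rfl).const_smul Complex.I)
  have hR := (hhor 1 (by simp)).sub (hhor (-1) (by simp))
  simp only [one_mul, neg_one_mul, sub_zero] at hR
  simp only [Complex.ofReal_zero, zero_add, id] at hL
  have heq := tendsto_nhds_unique (hL.congr fun T => hrect' T) hR
  rw [← smul_sub, smul_eq_zero] at heq
  exact sub_eq_zero.1 (heq.resolve_left Complex.I_ne_zero)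

theorem laplace_remainder {α ω : ℝ} (hα₁ : 1 < α) (hα₂ : α < 2) (hω : 0 < ω) {p : ℂ}
    (hp : ω < p.re) :
    IntegrableOn (fun t : ℝ => (mittagLeffler α 1 ((Complex.I * ω) ^ (α : ℂ) * ((t ^ α : ℝ) : ℂ))
      - (α : ℂ)⁻¹ * Complex.exp (Complex.I * ω * t) - (1 - (α : ℂ)⁻¹) * Complex.exp (-t))
        * Complex.exp (-(p * t))) (Ioi 0) ∧
    ∫ t in Ioi (0 : ℝ), (mittagLeffler α 1 ((Complex.I * ω) ^ (α : ℂ) * ((t ^ α : ℝ) : ℂ))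
      - (α : ℂ)⁻¹ * Complex.exp (Complex.I * ω * t) - (1 - (α : ℂ)⁻¹) * Complex.exp (-t))
        * Complex.exp (-(p * t)) = remainderLaplace α ω p := by
  have hp0 : 0 < p.re := hω.trans hp
  have hne : p ≠ Complex.I * ω := by rintro rfl; simp at hp0
  have h1 := hasSum_laplaceTerm hα₁.le (μ := (Complex.I * ω) ^ (α : ℂ)) hp0 (by
    rw [Complex.norm_cpow_real]
    exact Real.rpow_lt_rpow (norm_nonneg _) (by simpa [abs_of_pos hω]) (by linarith))
  have hexp (q : ℂ) (hq : 0 < q.re) :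
      IntegrableOn (fun t : ℝ => Complex.exp (-(q * t))) (Ioi 0) ∧
        ∫ t in Ioi (0 : ℝ), Complex.exp (-(q * t)) = q⁻¹ := by
    have ha := integrableOn_exp_mul_complex_Ioi (a := -q) (by simpa) 0
    have hb := integral_exp_mul_complex_Ioi (a := -q) (by simpa) 0
    simp only [neg_mul] at ha hb
    exact ⟨ha, by rw [hb]; simp⟩
  have h2 := hexp (p - Complex.I * ω) (by simpa)
  have h3 := hexp (p + 1) (by simp; linarith)
  have hfun : (fun t : ℝ => (mittagLeffler α 1 ((Complex.I * ω) ^ (α : ℂ) * ((t ^ α : ℝ) : ℂ))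
      - (α : ℂ)⁻¹ * Complex.exp (Complex.I * ω * t) - (1 - (α : ℂ)⁻¹) * Complex.exp (-t))
        * Complex.exp (-(p * t))) = fun t : ℝ =>
      (mittagLeffler α 1 ((Complex.I * ω) ^ (α : ℂ) * ((t ^ α : ℝ) : ℂ)) * Complex.exp (-(p * t))
      - (α : ℂ)⁻¹ * Complex.exp (-((p - Complex.I * ω) * t)))
      - (1 - (α : ℂ)⁻¹) * Complex.exp (-((p + 1) * t)) := by
    funext t
    rw [show -((p - Complex.I * ω) * t) = Complex.I * ω * t + -(p * t) by ring,
      show -((p + 1) * t) = -t + -(p * t) by ring, Complex.exp_add, Complex.exp_add]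
    ring
  rw [hfun]
  have i2 := h2.1.const_mul (α : ℂ)⁻¹
  have i3 := h3.1.const_mul (1 - (α : ℂ)⁻¹)
  refine ⟨(h1.1.sub i2).sub i3, (integral_sub (h1.1.sub i2) i3).trans ?_⟩
  have h12 := integral_sub h1.1 i2
  simp only [Pi.sub_apply]
  rw [h12, integral_const_mul, integral_const_mul,
    h1.2, h2.2, h3.2, remainderLaplace_of_ne hα₁ hα₂ hω hp0.le hne]
  rfl

theorem remainder_eq_integral {α ω : ℝ} (hα₁ : 1 < α) (hα₂ : α < 2) (hω : 0 < ω) {t : ℝ}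
    (ht : 0 ≤ t) :
    mittagLeffler α 1 ((Complex.I * ω) ^ (α : ℂ) * ((t ^ α : ℝ) : ℂ))
      - (α : ℂ)⁻¹ * Complex.exp (Complex.I * ω * t) - (1 - (α : ℂ)⁻¹) * Complex.exp (-t)
      = ∫ w : ℝ, Complex.exp (((2 * Real.pi * w : ℝ) : ℂ) * Complex.I * t)
          * remainderLaplace α ω (((2 * Real.pi * w : ℝ) : ℂ) * Complex.I) := by
  set v : ℝ → ℂ := fun t => mittagLeffler α 1 ((Complex.I * ω) ^ (α : ℂ) * ((t ^ α : ℝ) : ℂ))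
      - (α : ℂ)⁻¹ * Complex.exp (Complex.I * ω * t) - (1 - (α : ℂ)⁻¹) * Complex.exp (-t) with hv
  obtain ⟨R, K, -, hbd⟩ := exists_norm_remainderLaplace_le hα₁ hα₂ hω
  set V := remainderLaplace α ω with hVdef
  have hV : ∀ p : ℂ, 0 ≤ p.re → ContinuousAt V p := fun p hp =>
    continuousAt_remainderLaplace hα₁ hα₂ hω hp
  have hVd : ∀ p : ℂ, 0 < p.re → DifferentiableAt ℂ V p := fun p hp =>
    differentiableAt_remainderLaplace hα₁ hα₂ hω hp.le (by rintro rfl; simp at hp)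
  set c : ℝ := ω + 1 with hc
  have hc0 : 0 ≤ c := by linarith
  have hvcont : Continuous v := by
    have := continuous_mittagLeffler hα₁.le
    have : Continuous fun t : ℝ => t ^ α := Real.continuous_rpow_const (by linarith)
    fun_prop
  have hv0 : v 0 = 0 := by
    simp [hv, Real.zero_rpow (by linarith : α ≠ 0), mittagLeffler_zero]
  set f : ℝ → ℂ := fun t => v (max t 0) * Complex.exp (-(c * t)) with hf
  have hfcont : Continuous f := by fun_prop
  have hfind (q : ℝ → ℂ) : (fun t => q t * f t)
      = (Ioi (0 : ℝ)).indicator fun t => q t * (v t * Complex.exp (-(c * t))) := by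
    funext s
    by_cases hs : 0 < s
    · simp [hf, indicator_of_mem (mem_Ioi.2 hs), max_eq_left hs.le]
    · rw [indicator_of_notMem (by simpa using hs)]
      simp [hf, max_eq_right (not_lt.1 hs), hv0]
  have hfint : Integrable f := by
    have := hfind fun _ => 1
    simp only [one_mul] at this
    rw [show f = _ from this, integrable_indicator_iff measurableSet_Ioi]
    exact (laplace_remainder hα₁ hα₂ hω (p := c) (by simp [hc])).1
  have hfour : FourierTransform.fourier f
      = fun w : ℝ => V (c + ((2 * Real.pi * w : ℝ) : ℂ) * Complex.I) := by
    funext w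
    rw [Real.fourier_real_eq_integral_exp_smul]
    simp_rw [smul_eq_mul]
    rw [hfind, integral_indicator measurableSet_Ioi]
    refine Eq.trans ?_ (laplace_remainder hα₁ hα₂ hω
      (p := c + ((2 * Real.pi * w : ℝ) : ℂ) * Complex.I) (by simp [hc])).2
    congr 1
    funext s
    rw [mul_left_comm, ← Complex.exp_add]
    congr 2
    push_cast
    ring
  have hVint (b : ℝ) (hb : 0 ≤ b) :
      Integrable fun w : ℝ => V (b + ((2 * Real.pi * w : ℝ) : ℂ) * Complex.I) :=
    (integrable_vertical hV hbd hb).comp_mul_left' (g := fun y : ℝ => V (b + y * Complex.I))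
      (by positivity)
  have hinv := hfcont.fourierInv_fourier_eq hfint (by rw [hfour]; exact hVint c hc0)
  have ht' := congrFun hinv t
  rw [Real.fourierInv_eq', hfour] at ht'
  have hft : v t = Complex.exp (c * t) * f t := by
    rw [hf]
    simp only [max_eq_left ht]
    rw [mul_left_comm, ← Complex.exp_add]
    simp
  change v t = _
  rw [hft, ← ht', ← integral_const_mul]
  have hs := integral_vertical_shift hV hVd hbd hc0 ht
  have e1 := Measure.integral_comp_mul_left (fun y : ℝ =>
    Complex.exp ((c + y * Complex.I) * t) * V (c + y * Complex.I)) (2 * Real.pi)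
  have e2 := Measure.integral_comp_mul_left (fun y : ℝ =>
    Complex.exp (y * Complex.I * t) * V (y * Complex.I)) (2 * Real.pi)
  rw [hs] at e1
  rw [e2, ← e1]
  congr 1
  funext w
  rw [smul_eq_mul, ← mul_assoc, ← Complex.exp_add]
  congr 2
  simp
  ring

theorem tendsto_mittagLeffler_sub_exp {α ω : ℝ} (hα₁ : 1 < α) (hα₂ : α < 2) (hω : 0 < ω) :
    Tendsto (fun t : ℝ => mittagLeffler α 1 ((Complex.I * ω) ^ (α : ℂ) * ((t ^ α : ℝ) : ℂ))
      - (α : ℂ)⁻¹ * Complex.exp (Complex.I * ω * t)) atTop (nhds 0) := by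
  have hRL := (Real.tendsto_integral_exp_smul_cocompact
    fun w : ℝ => remainderLaplace α ω (((2 * Real.pi * w : ℝ) : ℂ) * Complex.I)).comp
    (tendsto_neg_atTop_atBot.mono_right atBot_le_cocompact)
  have hexp : Tendsto (fun t : ℝ => (1 - (α : ℂ)⁻¹) * Complex.exp (-t)) atTop (nhds 0) := by
    have h := (Complex.continuous_ofReal.tendsto 0).comp Real.tendsto_exp_neg_atTop_nhds_zero
    simpa [Function.comp_def] using h.const_mul (1 - (α : ℂ)⁻¹)
  have := hRL.add hexp
  rw [add_zero] at this
  refine this.congr' ?_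
  filter_upwards [eventually_ge_atTop 0] with t ht
  rw [sub_eq_iff_eq_add.1 (remainder_eq_integral hα₁ hα₂ hω ht)]
  congr 1
  simp only [Function.comp_apply]
  congr 1
  funext w
  rw [Circle.smul_def, Real.fourierChar_apply, smul_eq_mul]
  congr 2
  push_cast
  ring

theorem exists_norm_le_of_tendsto_sub_exp {e : ℝ → ℂ} (he : Continuous e) {a : ℂ} {ω : ℝ}
    (h : Tendsto (fun t : ℝ => e t - a * Complex.exp (Complex.I * ω * t)) atTop (nhds 0)) :
    ∃ B, ∀ t, 0 ≤ t → ‖e t‖ ≤ B := by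
  have h1 := h.norm.eventually (gt_mem_nhds (by simp : ‖(0 : ℂ)‖ < 1))
  obtain ⟨T, hT⟩ := eventually_atTop.1 h1
  obtain ⟨B, hB⟩ := (isCompact_Icc (a := (0 : ℝ)) (b := T)).exists_bound_of_continuousOn
    he.continuousOn
  refine ⟨max B (1 + ‖a‖), fun t ht => ?_⟩
  rcases le_total t T with htT | htT
  · exact (hB t ⟨ht, htT⟩).trans (le_max_left _ _)
  · refine le_trans ?_ (le_max_right _ _)
    calc ‖e t‖ = ‖(e t - a * Complex.exp (Complex.I * ω * t))
          + a * Complex.exp (Complex.I * ω * t)‖ := by rw [sub_add_cancel]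
      _ ≤ 1 + ‖a‖ := by
        refine (norm_add_le _ _).trans (add_le_add (hT t htT).le ?_)
        simp [Complex.norm_exp]

theorem eventually_half_le_norm_of_tendsto_sub_exp {e : ℝ → ℂ} {a : ℂ} (ha : a ≠ 0) {ω : ℝ}
    (h : Tendsto (fun t : ℝ => e t - a * Complex.exp (Complex.I * ω * t)) atTop (nhds 0)) :
    ∀ᶠ t in atTop, ‖a‖ / 2 ≤ ‖e t‖ := by
  filter_upwards [h.norm.eventually
    (gt_mem_nhds (by simpa using ha : ‖(0 : ℂ)‖ < ‖a‖ / 2))] with t ht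
  have h1 := norm_sub_norm_le (a * Complex.exp (Complex.I * ω * t)) (e t)
  rw [norm_sub_rev] at h1
  have h2 : ‖a * Complex.exp (Complex.I * ω * t)‖ = ‖a‖ := by
    simp [Complex.norm_exp]
  linarith

theorem tendsto_shift_div_of_tendsto_sub_exp {e : ℝ → ℂ} {a : ℂ} (ha : a ≠ 0) {ω : ℝ}
    (h : Tendsto (fun t : ℝ => e t - a * Complex.exp (Complex.I * ω * t)) atTop (nhds 0)) (s : ℝ) :
    Tendsto (fun t : ℝ => e (t - s) / e t) atTop (nhds (Complex.exp (-(Complex.I * ω * s)))) := by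
  have hn (t : ℝ) : ‖Complex.exp (-(Complex.I * ω * t))‖ = 1 := by simp [Complex.norm_exp]
  have hlim : Tendsto (fun t : ℝ => e t * Complex.exp (-(Complex.I * ω * t))) atTop (nhds a) := by
    have h0 : Tendsto (fun t : ℝ => (e t - a * Complex.exp (Complex.I * ω * t))
        * Complex.exp (-(Complex.I * ω * t))) atTop (nhds 0) := by
      refine squeeze_zero_norm (fun t => ?_) (by simpa using h.norm)
      rw [norm_mul, hn, mul_one]
    have := h0.add_const a
    rw [zero_add] at this
    refine this.congr fun t => ?_
    rw [sub_mul, mul_assoc a, ← Complex.exp_add]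
    simp
  have hs : Tendsto (fun t : ℝ => t - s) atTop atTop :=
    tendsto_atTop_add_const_right _ (-s) tendsto_id
  have := ((hlim.comp hs).div hlim ha).mul_const (Complex.exp (-(Complex.I * ω * s)))
  rw [div_self ha, one_mul] at this
  refine this.congr fun t => ?_
  have hexp : Complex.exp (-(Complex.I * ω * (t - s : ℝ))) * Complex.exp (-(Complex.I * ω * s))
      = Complex.exp (-(Complex.I * ω * t)) := by
    rw [← Complex.exp_add]
    push_cast
    ring_nf
  simp only [Function.comp_apply, Pi.div_apply]
  rw [div_mul_eq_mul_div, mul_assoc, hexp, mul_div_mul_right _ _ (Complex.exp_ne_zero _)]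

/-- If `e` is asymptotic to a multiple of `t ↦ e^{iωt}`, then the Duhamel-type integrals
`∫ ∫_0^t G ξ (t - τ) e(τ) dτ dξ`, divided by `e(t)`, converge to the time Fourier transform of `G`
at `ω`, integrated over `ξ`. -/
theorem tendsto_integral_convolution_div {X : Type*} [MeasurableSpace X] {ν : Measure X} [SFinite ν]
    {e : ℝ → ℂ} (he : Continuous e) {a : ℂ} (ha : a ≠ 0) {ω : ℝ}
    (h : Tendsto (fun t : ℝ => e t - a * Complex.exp (Complex.I * ω * t)) atTop (nhds 0))
    {G : X → ℝ → ℂ}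
    (hG : Integrable (Function.uncurry G) (ν.prod (volume.restrict (Ioi 0)))) :
    Tendsto (fun t : ℝ => (∫ ξ, (∫ τ in (0 : ℝ)..t, G ξ (t - τ) * e τ) ∂ν) / e t) atTop
      (nhds (∫ ξ, (∫ s in Ioi (0 : ℝ), G ξ s * Complex.exp (-(Complex.I * ω * s))) ∂ν)) := by
  obtain ⟨B, hB⟩ := exists_norm_le_of_tendsto_sub_exp he h
  have hB0 : 0 ≤ B := (norm_nonneg _).trans (hB 0 le_rfl)
  set w : ℝ → ℝ → ℂ := fun t s => (Iio t).indicator (fun s => e (t - s) / e t) s with hw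
  have hwmeas (t : ℝ) : Measurable (w t) :=
    (Continuous.measurable (by fun_prop)).indicator measurableSet_Iio
  have hwbd (t : ℝ) (ht : ‖a‖ / 2 ≤ ‖e t‖) (s : ℝ) : ‖w t s‖ ≤ B / (‖a‖ / 2) := by
    have ha' : 0 < ‖a‖ / 2 := by simpa using ha
    rw [hw]
    by_cases hs : s < t
    · simp only [indicator_of_mem (mem_Iio.2 hs), norm_div]
      have := hB (t - s) (by linarith)
      gcongr
    · simp only [indicator_of_notMem (show s ∉ Iio t by simpa using hs), norm_zero]
      positivity
  have hint (t : ℝ) (ht : ‖a‖ / 2 ≤ ‖e t‖) :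
      Integrable (fun q : X × ℝ => w t q.2 * G q.1 q.2) (ν.prod (volume.restrict (Ioi 0))) :=
    hG.bdd_mul (c := B / (‖a‖ / 2)) ((hwmeas t).comp measurable_snd).aestronglyMeasurable
      (ae_of_all _ fun q => hwbd t ht q.2)
  have hlim : Tendsto (fun t : ℝ => ∫ q : X × ℝ, w t q.2 * G q.1 q.2
      ∂(ν.prod (volume.restrict (Ioi 0)))) atTop
      (nhds (∫ q : X × ℝ, Complex.exp (-(Complex.I * ω * q.2)) * G q.1 q.2
        ∂(ν.prod (volume.restrict (Ioi 0))))) := by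
    refine tendsto_integral_filter_of_dominated_convergence
      (fun q => B / (‖a‖ / 2) * ‖Function.uncurry G q‖) ?_ ?_ (hG.norm.const_mul _) ?_
    · filter_upwards [eventually_half_le_norm_of_tendsto_sub_exp ha h] with t ht
      exact (hint t ht).aestronglyMeasurable
    · filter_upwards [eventually_half_le_norm_of_tendsto_sub_exp ha h] with t ht
      refine ae_of_all _ fun q => ?_
      rw [norm_mul]
      exact mul_le_mul_of_nonneg_right (hwbd t ht q.2) (norm_nonneg _)
    · refine ae_of_all _ fun q => Tendsto.mul_const _ ?_
      refine (tendsto_shift_div_of_tendsto_sub_exp ha h q.2).congr' ?_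
      filter_upwards [eventually_gt_atTop q.2] with t ht
      simp [hw, indicator_of_mem (mem_Iio.2 ht)]
  have hexp : Integrable (fun q : X × ℝ => Complex.exp (-(Complex.I * ω * q.2)) * G q.1 q.2)
      (ν.prod (volume.restrict (Ioi 0))) := by
    refine hG.bdd_mul (c := 1) (Measurable.aestronglyMeasurable (by fun_prop)) ?_
    exact ae_of_all _ fun q => by simp [Complex.norm_exp]
  rw [integral_prod _ hexp] at hlim
  simp_rw [mul_comm (Complex.exp _)] at hlim
  refine hlim.congr' ?_
  filter_upwards [eventually_half_le_norm_of_tendsto_sub_exp ha h, eventually_ge_atTop 0]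
    with t ht ht0
  rw [integral_prod _ (hint t ht), ← integral_div]
  congr 1
  funext ξ
  have hsub := intervalIntegral.integral_comp_sub_left (a := 0) (b := t)
    (fun s => G ξ s * e (t - s)) t
  simp only [sub_sub_cancel, sub_self, sub_zero] at hsub
  rw [hsub, intervalIntegral.integral_of_le ht0, ← integral_div, integral_Ioc_eq_integral_Ioo,
    ← Ioi_inter_Iio, ← setIntegral_indicator measurableSet_Iio]
  congr 1
  funext s
  by_cases hs : s < t
  · simp only [hw, indicator_of_mem (mem_Iio.2 hs)]
    ring
  · simp [hw, indicator_of_notMem (show s ∉ Iio t by simpa using hs)]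

theorem measurable_wrightPhi (α δ : ℝ) : Measurable (wrightPhi α δ) :=
  Measurable.tsum fun m => by fun_prop

theorem measurable_fWright (α μ δ : ℝ) : Measurable fun z => fWright α z μ δ := by
  have hm := measurable_wrightPhi α δ
  have : StronglyMeasurable fun q : ℝ × ℝ =>
      wrightPhi α δ (-(q.1 * q.2)) * (q.2 ^ 2 - 1) ^ (μ / 2 - 1) :=
    Measurable.stronglyMeasurable (by fun_prop)
  exact (this.integral_prod_right (ν := volume.restrict (Ioi 1))).measurable.const_mul _

theorem measurable_GammaKer (α : ℝ) (n : ℕ) :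
    Measurable fun q : EuclideanSpace ℝ (Fin n) × ℝ => GammaKer α n q.1 q.2 := by
  have h := measurable_fWright α ((n : ℝ) - 1) (α - α * n / 2)
  have h2 : Measurable fun q : EuclideanSpace ℝ (Fin n) × ℝ => q.2 ^ (-α / 2) * ‖q.1‖ := by fun_prop
  unfold GammaKer
  exact Measurable.mul (by fun_prop) (h.comp h2)

theorem rpow_mul_mun_le {n : ℕ} (hn : 3 ≤ n) {z : ℝ} (hz : 0 < z) :
    z ^ ((n : ℝ) - 2) * mun n z ≤ 2 * (z * (1 + z ^ 2)) := by
  unfold mun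
  split_ifs with h3 h4
  · subst h3
    norm_num
    nlinarith [pow_pos hz 3]
  · subst h4
    have h1 : |Real.log z| ≤ z + z⁻¹ := by
      have := Real.log_le_self hz.le
      have h2 := Real.log_le_self (inv_pos.2 hz).le
      rw [Real.log_inv] at h2
      have := inv_pos.2 hz
      rw [abs_le]
      constructor <;> linarith
    have h2 : z ^ (((4 : ℕ) : ℝ) - 2) = z ^ 2 := by
      rw [← Real.rpow_natCast]; norm_num
    rw [h2]
    calc z ^ 2 * (1 + |Real.log z|) ≤ z ^ 2 * (1 + (z + z⁻¹)) := by gcongr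
      _ = z ^ 2 + z ^ 3 + z := by field_simp; ring
      _ ≤ 2 * (z * (1 + z ^ 2)) := by nlinarith [mul_nonneg hz.le (sq_nonneg (z - 1)), pow_pos hz 3]
  · rw [← Real.rpow_add hz, show (n : ℝ) - 2 + (4 - n) = (2 : ℕ) by push_cast; ring,
      Real.rpow_natCast]
    nlinarith [mul_nonneg hz.le (sq_nonneg (z - 1)), pow_pos hz 3]

/-- The profile dominating the kernel after the similarity substitution `z = s^{-α/2} r`. -/
noncomputable def kernelProfile (α σ z : ℝ) : ℝ :=
  (1 + z ^ 2) * Real.exp (-σ * z ^ (2 / (2 - α)))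

theorem integrableOn_kernelProfile {α σ : ℝ} (hα₂ : α < 2) (hσ : 0 < σ) :
    IntegrableOn (kernelProfile α σ) (Ioi 0) := by
  have hq : 0 < 2 / (2 - α) := div_pos two_pos (by linarith)
  have h0 := integrableOn_rpow_mul_exp_neg_mul_rpow (s := 0) (by norm_num) hq hσ
  have h2 := integrableOn_rpow_mul_exp_neg_mul_rpow (s := 2) (by norm_num) hq hσ
  refine (h0.add h2).congr_fun (fun z _ => ?_) measurableSet_Ioi
  simp only [Pi.add_apply, Real.rpow_zero, Real.rpow_two, kernelProfile]
  ring

theorem kernel_bound_le {α σ C : ℝ} {n : ℕ} (hn : 3 ≤ n) (hC : 0 < C) {r s : ℝ} (hr : 0 < r)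
    (hs : 0 < s) :
    C * s ^ (α - α * n / 2 - 1) * mun n (s ^ (-α / 2) * r)
        * Real.exp (-σ * (s ^ (-α / 2) * r) ^ (2 / (2 - α)))
      ≤ 2 * C * r ^ (2 - n : ℝ)
        * (s ^ (-α / 2 - 1) * (r * kernelProfile α σ (r * s ^ (-α / 2)))) := by
  set z := s ^ (-α / 2) * r with hz
  have hz0 : 0 < z := by positivity
  have h1 : s ^ (α - α * n / 2 - 1) = s⁻¹ * r ^ (2 - n : ℝ) * z ^ ((n : ℝ) - 2) := by
    rw [hz, Real.mul_rpow (by positivity) hr.le, ← Real.rpow_mul hs.le, mul_mul_mul_comm,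
      ← Real.rpow_add hr, ← Real.rpow_neg_one, ← Real.rpow_add hs]
    ring_nf
    simp
  have h2 : s ^ (-α / 2 - 1) * r = s⁻¹ * z := by
    rw [hz, Real.rpow_sub_one hs.ne']
    ring
  have h3 : 2 * C * r ^ (2 - n : ℝ)
      * (s ^ (-α / 2 - 1) * (r * kernelProfile α σ (r * s ^ (-α / 2))))
      = C * s⁻¹ * r ^ (2 - n : ℝ) * (2 * (z * (1 + z ^ 2)))
        * Real.exp (-σ * z ^ (2 / (2 - α))) := by
    rw [← mul_assoc (s ^ _), h2, mul_comm r, ← hz, kernelProfile]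
    ring
  rw [h3, h1]
  have := rpow_mul_mun_le hn hz0
  calc C * (s⁻¹ * r ^ (2 - n : ℝ) * z ^ ((n : ℝ) - 2)) * mun n z
        * Real.exp (-σ * z ^ (2 / (2 - α)))
      = C * s⁻¹ * r ^ (2 - n : ℝ) * (z ^ ((n : ℝ) - 2) * mun n z)
        * Real.exp (-σ * z ^ (2 / (2 - α))) := by ring
    _ ≤ _ := by gcongr

theorem integral_kernelProfile_comp {α σ : ℝ} (hα : 0 < α) (hα₂ : α < 2) (hσ : 0 < σ) {r : ℝ}
    (hr : 0 < r) :
    IntegrableOn (fun s => s ^ (-α / 2 - 1) * (r * kernelProfile α σ (r * s ^ (-α / 2)))) (Ioi 0) ∧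
    ∫ s in Ioi (0 : ℝ), s ^ (-α / 2 - 1) * (r * kernelProfile α σ (r * s ^ (-α / 2)))
      = 2 / α * ∫ z in Ioi (0 : ℝ), kernelProfile α σ z := by
  have hp : -α / 2 ≠ 0 := div_ne_zero (neg_ne_zero.2 hα.ne') two_ne_zero
  have hi : IntegrableOn (fun y => r * kernelProfile α σ (r * y)) (Ioi 0) := by
    have := (integrableOn_Ioi_comp_mul_left_iff (kernelProfile α σ) 0 hr).2
      (by simpa using integrableOn_kernelProfile hα₂ hσ)
    exact this.const_mul r
  have h1 := (integrableOn_Ioi_comp_rpow_iff' (fun y => r * kernelProfile α σ (r * y)) hp).2 hi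
  refine ⟨by simpa using h1, ?_⟩
  have h2 := integral_comp_rpow_Ioi (fun y => r * kernelProfile α σ (r * y)) hp
  have h3 : |-α / 2| = α / 2 := by rw [neg_div, abs_neg, abs_of_pos (by positivity)]
  simp only [smul_eq_mul, h3, mul_assoc] at h2
  rw [integral_const_mul, integral_const_mul, integral_comp_mul_left_Ioi _ _ hr] at h2
  simp only [smul_eq_mul, mul_zero, mul_inv_cancel_left₀ hr.ne'] at h2
  rw [← h2, ← mul_assoc, div_mul_div_cancel₀ hα.ne', div_self two_ne_zero, one_mul]

theorem integrable_norm_sub_rpow_mul {n : ℕ} (hn : 3 ≤ n) {F : EuclideanSpace ℝ (Fin n) → ℂ}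
    (hF : Integrable F) {M : ℝ} (hM : ∀ ξ, ‖F ξ‖ ≤ M) (x : EuclideanSpace ℝ (Fin n)) :
    Integrable fun ξ => ‖x - ξ‖ ^ (2 - n : ℝ) * ‖F ξ‖ := by
  have : Nonempty (Fin n) := ⟨⟨0, by omega⟩⟩
  have hn' : (3 : ℝ) ≤ n := by exact_mod_cast hn
  have hloc : Integrable fun y : EuclideanSpace ℝ (Fin n) =>
      (Iio (1 : ℝ)).indicator (fun r => r ^ (2 - n : ℝ)) ‖y‖ := by
    rw [integrable_fun_norm_addHaar]
    have h1 : IntegrableOn (fun y : ℝ => y) (Ioo 0 1) :=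
      (continuous_id.integrableOn_Icc (a := 0) (b := 1)).mono_set Ioo_subset_Icc_self
    have h2 : IntegrableOn ((Iio (1 : ℝ)).indicator fun y => y) (Ioi 0) := by
      rw [integrableOn_indicator_iff measurableSet_Iio, inter_comm]
      rwa [Ioi_inter_Iio]
    refine h2.congr_fun (fun y hy => ?_) measurableSet_Ioi
    have hy0 : 0 < y := hy
    by_cases h : y < 1
    · simp only [indicator_of_mem (mem_Iio.2 h), smul_eq_mul, finrank_euclideanSpace,
        Fintype.card_fin]
      rw [← Real.rpow_natCast, ← Real.rpow_add hy0, Nat.cast_sub (by omega)]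
      ring_nf
      simp
    · simp [indicator_of_notMem (show y ∉ Iio (1 : ℝ) by simpa using h)]
  have hM0 : 0 ≤ M := (norm_nonneg _).trans (hM 0)
  refine Integrable.mono' (hF.norm.add ((hloc.comp_sub_left x).const_mul M)) ?_ ?_
  · exact AEStronglyMeasurable.mul (Measurable.aestronglyMeasurable (by fun_prop))
      hF.aestronglyMeasurable.norm
  · refine ae_of_all _ fun ξ => ?_
    rw [norm_mul, norm_norm, Real.norm_of_nonneg (by positivity)]
    simp only [Pi.add_apply]
    by_cases h : ‖x - ξ‖ < 1
    · rw [indicator_of_mem (mem_Iio.2 h), mul_comm]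
      have : 0 ≤ ‖x - ξ‖ ^ (2 - n : ℝ) := by positivity
      nlinarith [mul_le_mul_of_nonneg_right (hM ξ) this, norm_nonneg (F ξ)]
    · rw [indicator_of_notMem (by simpa using h), mul_zero, add_zero]
      exact mul_le_of_le_one_left (norm_nonneg _)
        (Real.rpow_le_one_of_one_le_of_nonpos (not_lt.1 h) (by linarith))

theorem integrable_GammaKer_mul {α : ℝ} {n : ℕ} (hα₁ : 1 < α) (hα₂ : α < 2) (hn : 3 ≤ n)
    {C σ : ℝ} (hC : 0 < C) (hσ : 0 < σ)
    (hbd : ∀ t : ℝ, 0 < t → ∀ x : EuclideanSpace ℝ (Fin n), x ≠ 0 →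
      |GammaKer α n x t| ≤ C * t ^ (α - α * n / 2 - 1) * mun n (t ^ (-α / 2) * ‖x‖)
        * Real.exp (-σ * (t ^ (-α / 2) * ‖x‖) ^ (2 / (2 - α))))
    {F : EuclideanSpace ℝ (Fin n) → ℂ} (hF : Measurable F) (hFint : Integrable F)
    {M : ℝ} (hM : ∀ ξ, ‖F ξ‖ ≤ M) (x : EuclideanSpace ℝ (Fin n)) :
    Integrable (Function.uncurry fun ξ s => (GammaKer α n (x - ξ) s : ℂ) * F ξ)
      (volume.prod (volume.restrict (Ioi 0))) := by
  have : Nonempty (Fin n) := ⟨⟨0, by omega⟩⟩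
  have hmeas : Measurable (Function.uncurry fun ξ s => (GammaKer α n (x - ξ) s : ℂ) * F ξ) := by
    have h1 : Measurable fun q : EuclideanSpace ℝ (Fin n) × ℝ => GammaKer α n (x - q.1) q.2 :=
      (measurable_GammaKer α n).comp (by fun_prop : Measurable fun q :
        EuclideanSpace ℝ (Fin n) × ℝ => (x - q.1, q.2))
    exact Measurable.mul (by fun_prop) (by fun_prop)
  have hne : ∀ᵐ ξ : EuclideanSpace ℝ (Fin n), ξ ≠ x := by simp [ae_iff]
  have hker (ξ : EuclideanSpace ℝ (Fin n)) (hξ : ξ ≠ x) (s : ℝ) (hs : 0 < s) :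
      ‖(GammaKer α n (x - ξ) s : ℂ) * F ξ‖ ≤ 2 * C * ‖x - ξ‖ ^ (2 - n : ℝ) * ‖F ξ‖
        * (s ^ (-α / 2 - 1) * (‖x - ξ‖ * kernelProfile α σ (‖x - ξ‖ * s ^ (-α / 2)))) := by
    have hx : x - ξ ≠ 0 := sub_ne_zero.2 hξ.symm
    rw [norm_mul, Complex.norm_real, Real.norm_eq_abs, mul_right_comm _ ‖F ξ‖]
    gcongr
    exact (hbd s hs _ hx).trans (kernel_bound_le hn hC (norm_pos_iff.2 hx) hs)
  have hdom (ξ : EuclideanSpace ℝ (Fin n)) (hξ : ξ ≠ x) :=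
    integral_kernelProfile_comp (by linarith : 0 < α) hα₂ hσ
      (norm_pos_iff.2 (sub_ne_zero.2 hξ.symm : x - ξ ≠ 0))
  have hint (ξ : EuclideanSpace ℝ (Fin n)) (hξ : ξ ≠ x) :
      IntegrableOn (fun s => (GammaKer α n (x - ξ) s : ℂ) * F ξ) (Ioi 0) := by
    refine Integrable.mono' ((hdom ξ hξ).1.const_mul (2 * C * ‖x - ξ‖ ^ (2 - n : ℝ) * ‖F ξ‖))
      (hmeas.comp measurable_prodMk_left).aestronglyMeasurable ?_
    filter_upwards [ae_restrict_mem measurableSet_Ioi] with s hs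
    exact hker ξ hξ s hs
  rw [integrable_prod_iff hmeas.aestronglyMeasurable]
  refine ⟨by filter_upwards [hne] with ξ hξ using hint ξ hξ, ?_⟩
  refine Integrable.mono' ((integrable_norm_sub_rpow_mul hn hFint hM x).const_mul
    (2 * C * (2 / α * ∫ z in Ioi (0 : ℝ), kernelProfile α σ z)))
    hmeas.norm.stronglyMeasurable.integral_prod_right'.aestronglyMeasurable ?_
  filter_upwards [hne] with ξ hξ
  rw [Real.norm_of_nonneg (integral_nonneg fun s => norm_nonneg _)]
  refine (setIntegral_mono_on (hint ξ hξ).norm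
    ((hdom ξ hξ).1.const_mul (2 * C * ‖x - ξ‖ ^ (2 - n : ℝ) * ‖F ξ‖)) measurableSet_Ioi
    fun s hs => hker ξ hξ s hs).trans_eq ?_
  rw [integral_const_mul, (hdom ξ hξ).2]
  ring

theorem exp_mul_rpow_eq_I_mul_cpow {α ω : ℝ} (hω : 0 < ω) :
    Complex.exp (Real.pi * α / 2 * Complex.I) * ((ω ^ α : ℝ) : ℂ)
      = (Complex.I * ω) ^ (α : ℂ) := by
  have hω' : (ω : ℂ) ≠ 0 := Complex.ofReal_ne_zero.2 hω.ne'
  rw [Complex.cpow_def_of_ne_zero (mul_ne_zero Complex.I_ne_zero hω'),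
    Complex.log_mul_ofReal _ hω _ Complex.I_ne_zero, Complex.log_I, Complex.ofReal_cpow hω.le,
    Complex.cpow_def_of_ne_zero hω', Complex.ofReal_log hω.le, ← Complex.exp_add]
  ring_nf

/-- Principle of limiting amplitude for the inhomogeneous term: with
`k(t,x) = ∫_0^t Γ_{α,n}(x, t-τ) E_α(i^α ω^α τ^α) dτ` and
`u₃(t,x) = ∫ k(t, x-ξ) F(ξ) dξ`, for every `x`,
`u₃(t,x)/E_α(i^α ω^α t^α) → ∫ [∫_0^∞ Γ_{α,n}(x-ξ, τ) e^{-iωτ} dτ] F(ξ) dξ` as `t → ∞`. -/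
theorem limiting_amplitude_inhomogeneous_term
    (α ω : ℝ) (n : ℕ) (hα₁ : 1 < α) (hα₂ : α < 2) (hn : 3 ≤ n) (hω : 0 < ω)
    (μ : ℂ) (hμ : μ = Complex.exp (Real.pi * α / 2 * Complex.I) * ((ω ^ α : ℝ) : ℂ))
    (C σ : ℝ) (hC : 0 < C) (hσ : 0 < σ)
    (hbd : ∀ t : ℝ, 0 < t → ∀ x : EuclideanSpace ℝ (Fin n), x ≠ 0 →
      |GammaKer α n x t| ≤ C * t ^ (α - α * n / 2 - 1) * mun n (t ^ (-α / 2) * ‖x‖)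
        * Real.exp (-σ * (t ^ (-α / 2) * ‖x‖) ^ (2 / (2 - α))))
    (F : EuclideanSpace ℝ (Fin n) → ℂ) (hFmeas : Measurable F)
    (M : ℝ) (hM : ∀ ξ, ‖F ξ‖ ≤ M) (hFint : Integrable F)
    (k : ℝ → EuclideanSpace ℝ (Fin n) → ℂ)
    (hk : ∀ (t : ℝ) (x : EuclideanSpace ℝ (Fin n)),
      k t x = ∫ τ in (0 : ℝ)..t, (GammaKer α n x (t - τ) : ℂ)
        * mittagLeffler α 1 (μ * ((τ ^ α : ℝ) : ℂ)))
    (u₃ : ℝ → EuclideanSpace ℝ (Fin n) → ℂ)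
    (hu₃ : ∀ (t : ℝ) (x : EuclideanSpace ℝ (Fin n)),
      u₃ t x = ∫ ξ, k t (x - ξ) * F ξ) :
    ∀ x : EuclideanSpace ℝ (Fin n),
      Tendsto (fun t : ℝ => u₃ t x / mittagLeffler α 1 (μ * ((t ^ α : ℝ) : ℂ)))
        atTop
        (nhds (∫ ξ, (∫ τ in Ioi (0 : ℝ),
          (GammaKer α n (x - ξ) τ : ℂ) * Complex.exp (-(Complex.I * ω * τ))) * F ξ)) := by
  intro x
  subst hμ
  have hα0 : (α : ℂ)⁻¹ ≠ 0 := inv_ne_zero (Complex.ofReal_ne_zero.2 (by linarith))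
  have he : Continuous fun t : ℝ => mittagLeffler α 1
      (Complex.exp (Real.pi * α / 2 * Complex.I) * ((ω ^ α : ℝ) : ℂ) * ((t ^ α : ℝ) : ℂ)) := by
    have h1 := continuous_mittagLeffler hα₁.le
    have h2 : Continuous fun t : ℝ => t ^ α := Real.continuous_rpow_const (by linarith)
    fun_prop
  have hasymp := tendsto_mittagLeffler_sub_exp hα₁ hα₂ hω
  rw [← exp_mul_rpow_eq_I_mul_cpow hω] at hasymp
  have h := tendsto_integral_convolution_div he hα0 hasymp
    (integrable_GammaKer_mul hα₁ hα₂ hn hC hσ hbd hFmeas hFint hM x)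
  convert h using 4 with t ξ ξ
  · rw [hu₃]
    congr 1
    funext ξ
    rw [hk, ← intervalIntegral.integral_mul_const]
    congr 1
    funext τ
    ring
  · rw [← integral_mul_const]
    congr 1
    funext s
    ring
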